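/- Let L > 0 be real, let B_N ≥ 1 and B_D ≥ 1 be integers, set B = B_N + B_D and α = (1/π)·arcsin(√(B_D/B)). Define h : ℂ → ℂ by h(s) = (π/L)^{−2s} · [ ζ_H(2s, α) + ζ_H(2s, 1−α) + (B_D − B_N + (B_N−1)·2^{2s}) · ζ(2s) ]. Then the derivative of h at s = 0 equals −log( 2^B · L^{B_D} · B_D / (B·L) ). -/

import Mathlib

open Real Complex

open Set Filter Topology Asymptotics MeasureTheory HurwitzZeta

lemma one_sub_mul_exp_neg_mem_slitPlane {z : ℂ} (hz : ‖z‖ = 1) (hz1 : z ≠ 1) {t : ℝ}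
    (ht : 0 ≤ t) : 1 - z * cexp (-t) ∈ slitPlane := by
  have hn : ‖z * cexp (-t)‖ = rexp (-t) := by
    rw [norm_mul, hz, one_mul, Complex.norm_exp]; simp
  have hre := Complex.re_le_norm (z * cexp (-t))
  rw [hn] at hre
  rcases ht.eq_or_lt with rfl | ht
  · left
    simp only [ofReal_zero, neg_zero, Complex.exp_zero, mul_one] at *
    have : z.re ≠ 1 := by
      intro h
      apply hz1
      have h2 := Complex.sq_norm z
      rw [hz, Complex.normSq_apply, h] at h2
      apply Complex.ext <;> simp <;> nlinarith
    simp only [sub_re, one_re]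
    have := lt_of_le_of_ne ((Complex.re_le_norm z).trans hz.le) this
    linarith
  · left
    have : rexp (-t) < 1 := by simpa using ht
    simp only [sub_re, one_re]
    linarith

/-- The generating function of the Dirichlet coefficients `z ^ n` along `exp (-t)`. -/
noncomputable def geomKernel (z : ℂ) (t : ℝ) : ℂ := z * cexp (-t) / (1 - z * cexp (-t))

lemma continuousOn_geomKernel {z : ℂ} (hz : ‖z‖ = 1) (hz1 : z ≠ 1) :
    ContinuousOn (geomKernel z) (Ici 0) := by
  unfold geomKernel
  refine ContinuousOn.div (by fun_prop) (by fun_prop) fun t ht ↦ ?_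
  exact slitPlane_ne_zero (one_sub_mul_exp_neg_mem_slitPlane hz hz1 ht)

lemma tendsto_one_sub_mul_exp_neg (z : ℂ) :
    Tendsto (fun t : ℝ ↦ 1 - z * cexp (-t)) atTop (𝓝 1) := by
  have : Tendsto (fun t : ℝ ↦ cexp (-t)) atTop (𝓝 0) := by
    have := (Complex.continuous_ofReal.tendsto 0).comp Real.tendsto_exp_neg_atTop_nhds_zero
    simpa [Function.comp_def] using this
  simpa using tendsto_const_nhds.sub (this.const_mul z)

lemma isBigO_atTop_geomKernel (z : ℂ) :
    geomKernel z =O[atTop] fun t ↦ rexp (-1 * t) := by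
  have h1 : (fun t : ℝ ↦ z * cexp (-t)) =O[atTop] fun t ↦ rexp (-1 * t) := by
    refine IsBigO.of_bound ‖z‖ (Eventually.of_forall fun t ↦ ?_)
    simp [Complex.norm_exp]
  have h2 : (fun t : ℝ ↦ (1 - z * cexp (-t))⁻¹) =O[atTop] fun _ ↦ (1 : ℝ) :=
    ((tendsto_one_sub_mul_exp_neg z).inv₀ one_ne_zero).isBigO_one ℝ
  simpa only [geomKernel, div_eq_mul_inv, mul_one] using! h1.mul h2

lemma isBigO_zero_geomKernel {z : ℂ} (hz : ‖z‖ = 1) (hz1 : z ≠ 1) :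
    geomKernel z =O[𝓝[>] 0] fun t ↦ t ^ (-(0 : ℝ)) := by
  have := ((continuousOn_geomKernel hz hz1 0 self_mem_Ici).mono Ioi_subset_Ici_self).tendsto
  simpa using this.isBigO_one ℝ

lemma hasSum_geomKernel {z : ℂ} (hz : ‖z‖ = 1) {t : ℝ} (ht : 0 < t) :
    HasSum (fun n : ℕ ↦ z ^ (n + 1) * rexp (-(n + 1 : ℝ) * t)) (geomKernel z t) := by
  have hn : ‖z * cexp (-t)‖ < 1 := by
    rw [norm_mul, hz, one_mul, Complex.norm_exp]; simpa using ht
  have := (hasSum_geometric_of_norm_lt_one hn).mul_left (z * cexp (-t))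
  rw [← div_eq_mul_inv] at this
  convert! this using 2 with n
  rw [← pow_succ', mul_pow, ← Complex.exp_nat_mul]
  push_cast
  ring_nf

lemma mellin_geomKernel_one {z : ℂ} (hz : ‖z‖ = 1) (hz1 : z ≠ 1) :
    mellin (geomKernel z) 1 = -Complex.log (1 - z) := by
  have hint : MellinConvergent (geomKernel z) 1 :=
    mellinConvergent_of_isBigO_rpow_exp one_pos
      ((continuousOn_geomKernel hz hz1).mono Ioi_subset_Ici_self |>.locallyIntegrableOn
        measurableSet_Ioi) (isBigO_atTop_geomKernel _) (isBigO_zero_geomKernel hz hz1) (by simp)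
  have hint' : IntegrableOn (geomKernel z) (Ioi 0) := by
    simpa [MellinConvergent] using hint
  have hderiv : ∀ t ∈ Ici (0 : ℝ),
      HasDerivAt (fun t : ℝ ↦ Complex.log (1 - z * cexp (-t))) (geomKernel z t) t := by
    intro t ht
    have h1 : HasDerivAt (fun t : ℝ ↦ 1 - z * cexp (-t)) (z * cexp (-t)) t := by
      have := (((hasDerivAt_id t).ofReal_comp.neg.cexp).const_mul z).const_sub 1
      simpa using this
    exact h1.clog_real (one_sub_mul_exp_neg_mem_slitPlane hz hz1 ht)
  have hlim : Tendsto (fun t : ℝ ↦ Complex.log (1 - z * cexp (-t))) atTop (𝓝 0) := by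
    simpa using (tendsto_one_sub_mul_exp_neg z).clog (by simp)
  have := integral_Ioi_of_hasDerivAt_of_tendsto' hderiv hint' hlim
  simpa [mellin] using this

/-- For `1 < re s`, the Mellin transform of the geometric kernel is `Γ(s)` times `expZeta`. -/
lemma mellin_geomKernel {a : ℝ} {s : ℂ} (hs : 1 < s.re) :
    mellin (geomKernel (cexp (2 * π * I * a))) s = Complex.Gamma s * expZeta a s := by
  have hz : ‖cexp (2 * π * I * a)‖ = 1 := by
    simp [Complex.norm_exp]
  have hs0 : s ≠ 0 := by rintro rfl; norm_num at hs
  have h1 := hasSum_mellin (a := fun n : ℕ ↦ cexp (2 * π * I * a) ^ (n + 1))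
    (p := fun n : ℕ ↦ (n + 1 : ℝ)) (F := geomKernel (cexp (2 * π * I * a))) (s := s)
    (fun n ↦ Or.inr (by positivity)) (by linarith) (fun t ht ↦ hasSum_geomKernel hz ht) (by
      simp only [norm_pow, hz, one_pow]
      exact_mod_cast (summable_nat_add_iff 1).2 (Real.summable_one_div_nat_rpow.2 hs))
  have h2 := ((hasSum_nat_add_iff' 1).2 (hasSum_expZeta_of_one_lt_re a hs)).mul_left
    (Complex.Gamma s)
  simp only [Finset.range_one, Finset.sum_singleton, Nat.cast_zero, Complex.zero_cpow hs0,
    div_zero, sub_zero] at h2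
  refine h1.unique ?_
  convert! h2 using 2 with n
  rw [← Complex.exp_nat_mul, mul_div_assoc]
  push_cast
  ring_nf

lemma exp_two_pi_I_mul_ne_one {a : ℝ} (ha : (a : UnitAddCircle) ≠ 0) :
    cexp (2 * π * I * a) ≠ 1 := by
  intro h
  obtain ⟨n, hn⟩ := Complex.exp_eq_one_iff.1 h
  apply ha
  rw [AddCircle.coe_eq_zero_iff]
  refine ⟨n, ?_⟩
  have : (a : ℂ) = n := by
    have h0 := Complex.two_pi_I_ne_zero
    apply mul_left_cancel₀ h0
    rw [hn]; ring
  have : a = n := by exact_mod_cast this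
  simp [this]

/-- The value of the periodic zeta function at `s = 1`. -/
theorem expZeta_one {a : ℝ} (ha : (a : UnitAddCircle) ≠ 0) :
    expZeta a 1 = -Complex.log (1 - cexp (2 * π * I * a)) := by
  have hz : ‖cexp (2 * π * I * a)‖ = 1 := by
    simp [Complex.norm_exp]
  have hz1 := exp_two_pi_I_mul_ne_one ha
  rw [← mellin_geomKernel_one hz hz1]
  have hM : ContinuousAt (mellin (geomKernel (cexp (2 * π * I * a)))) 1 :=
    (mellin_differentiableAt_of_isBigO_rpow_exp one_pos
      ((continuousOn_geomKernel hz hz1).mono Ioi_subset_Ici_self |>.locallyIntegrableOn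
        measurableSet_Ioi) (isBigO_atTop_geomKernel _) (isBigO_zero_geomKernel hz hz1)
        (by simp)).continuousAt
  have hG : ContinuousAt (fun s ↦ Complex.Gamma s * expZeta a s) 1 :=
    ((Complex.differentiableAt_Gamma_one).mul
      (differentiable_expZeta_of_ne_zero ha 1)).continuousAt
  have hT : Tendsto (fun x : ℝ ↦ (x : ℂ)) (𝓝[>] 1) (𝓝 1) :=
    (Complex.continuous_ofReal.tendsto' 1 1 (by simp)).mono_left nhdsWithin_le_nhds
  have := tendsto_nhds_unique_of_eventuallyEq (hM.tendsto.comp hT) (hG.tendsto.comp hT) (by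
    filter_upwards [self_mem_nhdsWithin] with x hx
    exact mellin_geomKernel (by simpa using hx))
  rw [this, Complex.Gamma_one, one_mul]

/-- `∑ cos (2πna) / n = -log (2 sin πa)`, in terms of the continued function `cosZeta`. -/
theorem cosZeta_one {a : ℝ} (ha : (a : UnitAddCircle) ≠ 0) :
    cosZeta a 1 = -Real.log (2 * Real.sin (π * a)) := by
  have hna : ((-a : ℝ) : UnitAddCircle) ≠ 0 := by simpa using ha
  have hz : ‖cexp (2 * π * I * a)‖ = 1 := by
    simp [Complex.norm_exp]
  have hmem := one_sub_mul_exp_neg_mem_slitPlane hz (exp_two_pi_I_mul_ne_one ha) le_rfl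
  have hconj : 1 - cexp (2 * π * I * (-a : ℝ)) =
      (starRingEnd ℂ) (1 - cexp (2 * π * I * a)) := by
    simp [← Complex.exp_conj, Complex.conj_ofNat]
  have hnorm : ‖1 - cexp (2 * π * I * a)‖ = |2 * Real.sin (π * a)| := by
    have : 1 - cexp (2 * π * I * a) =
        (2 * Real.sin (π * a) : ℝ) * (-I * cexp (π * a * I)) := by
      push_cast
      rw [Complex.sin, show (2 * π * I * a : ℂ) = π * a * I + π * a * I by ring, Complex.exp_add,
        neg_mul, Complex.exp_neg]
      field_simp [Complex.exp_ne_zero]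
      linear_combination (1 - cexp (π * a * I) ^ 2) * I_sq
    rw [this, norm_mul, norm_mul, Complex.norm_exp, norm_real]
    simp
  rw [cosZeta_eq, ← AddCircle.coe_neg, expZeta_one ha, expZeta_one hna, hconj,
    Complex.log_conj _ (slitPlane_arg_ne_pi (by simpa using hmem)), ← neg_add,
    Complex.add_conj, Complex.log_re, hnorm, Real.log_abs]
  push_cast
  ring

/-- The derivative of the even Hurwitz zeta function at `s = 0`, from the functional equation. -/
theorem hasDerivAt_hurwitzZetaEven_zero {a : UnitAddCircle} (ha : a ≠ 0) :
    HasDerivAt (hurwitzZetaEven a) (cosZeta a 1 / 2) 0 := by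
  have hd : DifferentiableAt ℂ (fun s : ℂ ↦ 2 * (2 * π : ℂ) ^ (-s) * Complex.Gamma s * cosZeta a s)
      1 := by
    have h2pi : (2 * π : ℂ) ≠ 0 := by simp [pi_ne_zero]
    have hc := differentiable_cosZeta_of_ne_zero ha 1
    have hG := Complex.differentiableAt_Gamma_one
    have hp : DifferentiableAt ℂ (fun s : ℂ ↦ (2 * π : ℂ) ^ (-s)) 1 :=
      DifferentiableAt.const_cpow (by fun_prop) (Or.inl h2pi)
    fun_prop
  have hcos : HasDerivAt (fun s : ℂ ↦ Complex.cos (π * s / 2)) (-(π / 2)) 1 := by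
    have := (((hasDerivAt_id (1 : ℂ)).const_mul (π : ℂ)).div_const 2).ccos
    simpa using this
  have hmul := hd.hasDerivAt.mul hcos
  have hev : (fun s ↦ hurwitzZetaEven a (1 - s)) =ᶠ[𝓝 1] fun s ↦
      2 * (2 * π : ℂ) ^ (-s) * Complex.Gamma s * cosZeta a s * Complex.cos (π * s / 2) := by
    have : ∀ᶠ s : ℂ in 𝓝 1, 0 < s.re :=
      (Complex.continuous_re.tendsto 1).eventually (lt_mem_nhds (by simp))
    filter_upwards [this] with s hs
    rw [hurwitzZetaEven_one_sub a _ (Or.inl ha)]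
    · ring
    · rintro n rfl
      simp at hs
      exact absurd hs (by simp)
  have h := hmul.congr_of_eventuallyEq hev
  have h0 : HasDerivAt (fun s : ℂ ↦ 1 - s) (-1) 0 := by
    simpa using (hasDerivAt_id (0 : ℂ)).const_sub 1
  have := HasDerivAt.comp (0 : ℂ) (by simpa only [sub_zero] using h) h0
  simp only [Function.comp_def, sub_sub_cancel] at this
  convert! this using 1
  have : Complex.cos (π / 2 : ℂ) = 0 := by simp
  simp [this, Complex.cpow_neg]
  field_simp

lemma hurwitzZeta_add_one_sub (a : ℝ) (s : ℂ) :
    hurwitzZeta a s + hurwitzZeta ((1 - a : ℝ) : UnitAddCircle) s =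
      2 * hurwitzZetaEven a s := by
  have : ((1 - a : ℝ) : UnitAddCircle) = -a := by
    rw [AddCircle.coe_sub, AddCircle.coe_period, zero_sub]
  rw [this, hurwitzZetaEven_eq]
  ring

/-- with `h(s) = (π/L)^{−2s}[ζ_H(2s,α)+ζ_H(2s,1−α)+(B_D−B_N+(B_N−1)2^{2s})ζ(2s)]`,
`α = arcsin(√(B_D/B))/π`, `B = B_N + B_D`, one has
`h'(0) = −log(2^B L^{B_D} B_D/(B L))`. -/
theorem mixed_star_equal_lengths_zeta_deriv_zero (L : ℝ) (hL : 0 < L) (BN BD : ℕ)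
    (hBN : 1 ≤ BN) (hBD : 1 ≤ BD)
    (B : ℕ) (hB : B = BN + BD)
    (α : ℝ) (hα : α = Real.arcsin (Real.sqrt ((BD : ℝ) / (B : ℝ))) / Real.pi) :
    deriv (fun s : ℂ =>
        ((Real.pi / L : ℝ) : ℂ) ^ (-2 * s) *
          (HurwitzZeta.hurwitzZeta (α : UnitAddCircle) (2 * s) +
            HurwitzZeta.hurwitzZeta ((1 - α : ℝ) : UnitAddCircle) (2 * s) +
            ((BD : ℂ) - (BN : ℂ) + ((BN : ℂ) - 1) * (2 : ℂ) ^ (2 * s)) *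
              riemannZeta (2 * s))) 0 =
      -(Real.log (2 ^ B * L ^ BD * (BD : ℝ) / ((B : ℝ) * L)) : ℂ) := by
  have hBDpos : (0 : ℝ) < BD := by exact_mod_cast hBD
  have hBpos : (0 : ℝ) < B := by exact_mod_cast (by omega : 0 < B)
  have hle : (BD : ℝ) / B ≤ 1 := by
    rw [div_le_one hBpos]
    exact_mod_cast (by omega : BD ≤ B)
  have hsin : Real.sin (π * α) = √(BD / B) := by
    rw [hα, mul_div_cancel₀ _ pi_ne_zero, Real.sin_arcsin]
    · linarith [Real.sqrt_nonneg ((BD : ℝ) / B)]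
    · exact Real.sqrt_le_one.2 hle
  have hα0 : (α : UnitAddCircle) ≠ 0 := by
    intro h
    obtain ⟨n, hn⟩ := (AddCircle.coe_eq_zero_iff 1).1 h
    have hn' : α = n := by simpa using hn.symm
    rw [hn', mul_comm, Real.sin_int_mul_pi] at hsin
    exact (Real.sqrt_pos.2 (div_pos hBDpos hBpos)).ne hsin
  have hcos : cosZeta α 1 = ((-(Real.log 2 + (Real.log BD - Real.log B) / 2) : ℝ) : ℂ) := by
    rw [cosZeta_one hα0, hsin, Real.log_mul two_ne_zero
      (Real.sqrt_pos.2 (div_pos hBDpos hBpos)).ne', Real.log_sqrt (by positivity),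
      Real.log_div hBDpos.ne' hBpos.ne']
    push_cast
    ring
  have hlin : HasDerivAt (fun s : ℂ ↦ 2 * s) 2 0 := by
    simpa using (hasDerivAt_id (0 : ℂ)).const_mul 2
  have hlin' : HasDerivAt (fun s : ℂ ↦ -2 * s) (-2) 0 := by
    simpa using (hasDerivAt_id (0 : ℂ)).const_mul (-2)
  have hE : HasDerivAt (fun s : ℂ ↦ hurwitzZetaEven α (2 * s)) (cosZeta α 1 / 2 * 2) 0 :=
    HasDerivAt.comp (0 : ℂ) (by simpa only [mul_zero] using! hasDerivAt_hurwitzZetaEven_zero hα0) hlin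
  have hZ : HasDerivAt (fun s : ℂ ↦ riemannZeta (2 * s)) (-Real.log (2 * π) / 2 * 2) 0 := by
    refine HasDerivAt.comp (0 : ℂ) ?_ hlin
    have := (differentiableAt_riemannZeta (s := 0) (by simp)).hasDerivAt
    rw [deriv_riemannZeta_zero] at this
    rw [mul_zero, Complex.ofReal_log (by positivity)]
    exact_mod_cast this
  have hpi : (0 : ℝ) < π / L := by positivity
  have hP := hlin'.const_cpow (c := ((π / L : ℝ) : ℂ)) (Or.inl (by exact_mod_cast hpi.ne'))
  have hT := hlin.const_cpow (c := (2 : ℂ)) (Or.inl two_ne_zero)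
  have hmain := hP.mul ((hE.const_mul 2).add
    (((hT.const_mul ((BN : ℂ) - 1)).const_add ((BD : ℂ) - BN)).mul hZ))
  simp_rw [hurwitzZeta_add_one_sub]
  refine hmain.deriv.trans ?_
  have hlog2 : Complex.log 2 = Real.log 2 := by simp
  rw [hcos, ← Complex.ofReal_log hpi.le, hlog2]
  simp only [Pi.add_apply, Pi.mul_apply, mul_zero, Complex.cpow_zero, riemannZeta_zero,
    hurwitzZetaEven_apply_zero, if_neg hα0]
  have hBc : (B : ℝ) = BN + BD := by exact_mod_cast hB
  rw [Real.log_div pi_ne_zero hL.ne', Real.log_mul two_ne_zero pi_ne_zero,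
    Real.log_div (by positivity) (by positivity), Real.log_mul (by positivity) (by positivity),
    Real.log_mul (by positivity) (by positivity), Real.log_mul (by positivity) (by positivity),
    Real.log_pow, Real.log_pow]
  push_cast
  rw [show (B : ℂ) = BN + BD by exact_mod_cast hB]
  ring_nf
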